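/- arXiv:1110.4282 — 5 statements merged into one kernel-verified Lean document; each statement's English description precedes it below -/
import Mathlib

section
/- Let (X,ρ) be a separable metric space. Then there exist a separable Banach space V and an isometric isomorphism between the Banach space Lip_b(X), with norm ‖f‖_Lip = max(‖f‖_∞, L(f)), and the continuous dual space V* of V; that is, the bounded Lipschitz functions on X form a dual Banach space with separable pre-dual. -/
open scoped ENNReal NNReal

noncomputable section

/-- A real-valued function on a metric space is bounded and Lipschitz. -/
def IsBddLip {X : Type*} [PseudoMetricSpace X] (f : X → ℝ) : Prop :=
  (∃ C : ℝ≥0, LipschitzWith C f) ∧ ∃ M : ℝ, ∀ x, |f x| ≤ M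

/-- The least Lipschitz constant `L(f)`. -/
noncomputable def lipConst {X : Type*} [PseudoMetricSpace X] (f : X → ℝ) : ℝ≥0 :=
  sInf {C : ℝ≥0 | LipschitzWith C f}

/-- The norm `‖f‖_Lip = max (‖f‖_∞, L f)` on bounded Lipschitz functions. -/
noncomputable def lipNorm {X : Type*} [PseudoMetricSpace X] (f : X → ℝ) : ℝ :=
  max (⨆ x, |f x|) (lipConst f : ℝ)

/-- A witness that `Lip_b(X)` (bounded Lipschitz functions with the norm
`‖f‖_Lip = max(‖f‖_∞, L f)`) is isometrically isomorphic to the continuous dual of a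
separable Banach space `V`.  The map `T` is defined on representatives and is required
to be an isometric linear bijection from the set of bounded Lipschitz functions onto
the dual `V →L[ℝ] ℝ`. -/
structure PredualWitness (X : Type*) [MetricSpace X] where
  V : Type
  [normedV : NormedAddCommGroup V]
  [normedSpaceV : NormedSpace ℝ V]
  separableV : TopologicalSpace.SeparableSpace V
  completeV : CompleteSpace V
  T : (X → ℝ) → V →L[ℝ] ℝ
  map_add' : ∀ f g : X → ℝ, IsBddLip f → IsBddLip g → T (f + g) = T f + T g
  map_smul' : ∀ (c : ℝ) (f : X → ℝ), IsBddLip f → T (c • f) = c • T f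
  norm_eq : ∀ f : X → ℝ, IsBddLip f → ‖T f‖ = lipNorm f
  surj : ∀ φ : V →L[ℝ] ℝ, ∃ f : X → ℝ, IsBddLip f ∧ T f = φ
  inj : ∀ f g : X → ℝ, IsBddLip f → IsBddLip g → T f = T g → f = g

open scoped BoundedContinuousFunction

namespace LipPredual

set_option maxSynthPendingDepth 3

variable {X : Type} [MetricSpace X]

theorem lipschitzWith_lipConst {f : X → ℝ} (hf : IsBddLip f) : LipschitzWith (lipConst f) f := by
  refine LipschitzWith.of_dist_le_mul fun x y => ?_
  rcases eq_or_ne x y with rfl | hxy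
  · simp
  have hpos : 0 < dist x y := dist_pos.2 hxy
  rw [← div_le_iff₀ hpos]
  have hle : nndist (f x) (f y) / nndist x y ≤ lipConst f := le_csInf hf.1 fun C hC => by
    rw [← NNReal.coe_le_coe]
    exact (div_le_iff₀ hpos).2 (hC.dist_le_mul x y)
  exact NNReal.coe_le_coe.2 hle

theorem lipNorm_nonneg (f : X → ℝ) : 0 ≤ lipNorm f :=
  le_max_of_le_right (NNReal.coe_nonneg _)

theorem abs_le_lipNorm {f : X → ℝ} (hf : IsBddLip f) (x : X) : |f x| ≤ lipNorm f := by
  obtain ⟨M, hM⟩ := hf.2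
  exact le_max_of_le_left (le_ciSup ⟨M, Set.forall_mem_range.2 hM⟩ x)

theorem abs_sub_le_lipNorm {f : X → ℝ} (hf : IsBddLip f) (x y : X) :
    |f x - f y| ≤ lipNorm f * dist x y :=
  ((lipschitzWith_lipConst hf).dist_le_mul x y).trans
    (mul_le_mul_of_nonneg_right (le_max_right _ _) dist_nonneg)

theorem lipNorm_le {f : X → ℝ} {c : ℝ≥0} (hb : ∀ x, |f x| ≤ c) (hL : LipschitzWith c f) :
    lipNorm f ≤ c :=
  max_le (Real.iSup_le hb c.2) (NNReal.coe_le_coe.2 (csInf_le (OrderBot.bddBelow _) hL))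

variable (X) in
/-- The closed unit ball of `Lip_b(X)`, with the topology of pointwise convergence. -/
abbrev UnitBall : Type :=
  {f : X → ℝ // (∀ x, |f x| ≤ 1) ∧ ∀ x y, |f x - f y| ≤ dist x y}

/-- Evaluation at `x`, as a bounded continuous function on the unit ball of `Lip_b(X)`. -/
def delta (x : X) : UnitBall X →ᵇ ℝ :=
  BoundedContinuousFunction.ofNormedAddCommGroup (fun f => f.1 x)
    ((continuous_apply x).comp continuous_subtype_val) 1 fun f => f.2.1 x

theorem norm_delta_le (x : X) : ‖delta x‖ ≤ 1 :=
  (BoundedContinuousFunction.norm_le zero_le_one).2 fun f => f.2.1 x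

theorem norm_delta_sub_le (x y : X) : ‖delta x - delta y‖ ≤ dist x y :=
  (BoundedContinuousFunction.norm_le dist_nonneg).2 fun f => f.2.2 x y

variable (X) in
/-- The closed linear span of the evaluations. -/
abbrev evalSpan : Submodule ℝ (UnitBall X →ᵇ ℝ) :=
  (Submodule.span ℝ (Set.range delta)).topologicalClosure

/-- Evaluation at `x`, as an element of the closed span of the evaluations. -/
def point (x : X) : evalSpan X :=
  ⟨delta x, Submodule.le_topologicalClosure _ (Submodule.subset_span ⟨x, rfl⟩)⟩

theorem separableSpace_evalSpan [TopologicalSpace.SeparableSpace X] :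
    TopologicalSpace.SeparableSpace (evalSpan X) := by
  have hc : Continuous (delta : X → UnitBall X →ᵇ ℝ) :=
    (LipschitzWith.of_dist_le_mul (K := 1) fun x y => by
      simpa [dist_eq_norm] using norm_delta_sub_le x y).continuous
  exact ((TopologicalSpace.isSeparable_range hc).span (R := ℝ)).closure.separableSpace

theorem ext_point {φ ψ : evalSpan X →L[ℝ] ℝ} (h : ∀ x, φ (point x) = ψ (point x)) : φ = ψ := by
  have key : ∀ v (hv : v ∈ evalSpan X), φ ⟨v, hv⟩ = ψ ⟨v, hv⟩ := by
    have hs : ∀ v (hv : v ∈ Submodule.span ℝ (Set.range delta)),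
        φ ⟨v, Submodule.le_topologicalClosure _ hv⟩ =
          ψ ⟨v, Submodule.le_topologicalClosure _ hv⟩ := by
      intro v hv
      induction hv using Submodule.span_induction with
      | mem v hv => obtain ⟨x, rfl⟩ := hv; exact h x
      | zero => exact (map_zero φ).trans (map_zero ψ).symm
      | add v w hv hw hv' hw' =>
        have := congrArg₂ (· + ·) hv' hw'
        simp only [← map_add] at this
        exact this
      | smul a v hv hv' =>
        have := congrArg (a • ·) hv'
        simp only [← map_smul] at this
        exact this
    intro v hv
    have hd : Dense {w : evalSpan X | (w : UnitBall X →ᵇ ℝ) ∈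
        Submodule.span ℝ (Set.range delta)} := by
      intro w
      rw [closure_subtype]
      refine closure_mono (fun u hu => ?_) w.2
      exact ⟨⟨u, Submodule.le_topologicalClosure _ hu⟩, hu, rfl⟩
    exact congrFun (Continuous.ext_on hd φ.continuous ψ.continuous fun w hw => hs w hw) ⟨v, hv⟩
  exact ContinuousLinearMap.ext fun v => key v v.2

theorem exists_functional {f : X → ℝ} (hf : IsBddLip f) :
    ∃ φ : evalSpan X →L[ℝ] ℝ, (∀ x, φ (point x) = f x) ∧ ‖φ‖ ≤ lipNorm f := by
  rcases (lipNorm_nonneg f).eq_or_lt with h0 | hpos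
  · refine ⟨0, fun x => ?_, by simp [← h0]⟩
    have := abs_le_lipNorm hf x
    rw [← h0, abs_nonpos_iff] at this
    simp [this]
  set c := lipNorm f
  let g : UnitBall X := ⟨fun x => c⁻¹ * f x, fun x => by
      rw [abs_mul, abs_of_pos (inv_pos.2 hpos), inv_mul_le_iff₀ hpos, mul_one]
      exact abs_le_lipNorm hf x, fun x y => by
      rw [← mul_sub, abs_mul, abs_of_pos (inv_pos.2 hpos), inv_mul_le_iff₀ hpos]
      exact abs_sub_le_lipNorm hf x y⟩
  refine ⟨c • (BoundedContinuousFunction.evalCLM ℝ g).comp (evalSpan X).subtypeL,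
    fun x => ?_, ?_⟩
  · change c * (c⁻¹ * f x) = f x
    rw [mul_inv_cancel_left₀ hpos.ne']
  · refine ContinuousLinearMap.opNorm_le_bound _ hpos.le fun v => ?_
    change ‖c * (v : UnitBall X →ᵇ ℝ) g‖ ≤ _
    rw [norm_mul, Real.norm_of_nonneg hpos.le]
    exact mul_le_mul_of_nonneg_left ((v : UnitBall X →ᵇ ℝ).norm_coe_le_norm g) hpos.le

theorem abs_apply_point_le (φ : evalSpan X →L[ℝ] ℝ) (x : X) : |φ (point x)| ≤ ‖φ‖ :=
  φ.unit_le_opNorm _ (norm_delta_le x)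

theorem lipschitzWith_apply_point (φ : evalSpan X →L[ℝ] ℝ) :
    LipschitzWith ‖φ‖₊ fun x => φ (point x) :=
  LipschitzWith.of_dist_le_mul fun x y => by
    rw [Real.dist_eq, ← map_sub]
    exact φ.le_opNorm_of_le (norm_delta_sub_le x y)

theorem isBddLip_apply_point (φ : evalSpan X →L[ℝ] ℝ) : IsBddLip fun x => φ (point x) :=
  ⟨⟨_, lipschitzWith_apply_point φ⟩, _, abs_apply_point_le φ⟩

open Classical in
/-- The functional on the closed span of the evaluations represented by `f`, and `0` if `f` is
not bounded Lipschitz. -/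
def toDual (f : X → ℝ) : evalSpan X →L[ℝ] ℝ :=
  if hf : IsBddLip f then (exists_functional hf).choose else 0

theorem toDual_point {f : X → ℝ} (hf : IsBddLip f) (x : X) : toDual f (point x) = f x := by
  rw [toDual, dif_pos hf]
  exact (exists_functional hf).choose_spec.1 x

theorem norm_toDual {f : X → ℝ} (hf : IsBddLip f) : ‖toDual f‖ = lipNorm f := by
  refine le_antisymm ?_ ?_
  · rw [toDual, dif_pos hf]
    exact (exists_functional hf).choose_spec.2
  · have h := lipNorm_le (abs_apply_point_le (toDual f)) (lipschitzWith_apply_point (toDual f))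
    simpa only [toDual_point hf, coe_nnnorm] using h

theorem toDual_eq {f : X → ℝ} {φ : evalSpan X →L[ℝ] ℝ} (h : ∀ x, φ (point x) = f x) :
    toDual f = φ := by
  obtain rfl : (fun x => φ (point x)) = f := funext h
  exact ext_point fun x => toDual_point (isBddLip_apply_point φ) x

theorem toDual_add {f g : X → ℝ} (hf : IsBddLip f) (hg : IsBddLip g) :
    toDual (f + g) = toDual f + toDual g :=
  toDual_eq fun x => congrArg₂ (· + ·) (toDual_point hf x) (toDual_point hg x)

theorem toDual_smul (c : ℝ) {f : X → ℝ} (hf : IsBddLip f) : toDual (c • f) = c • toDual f :=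
  toDual_eq fun x => congrArg (c * ·) (toDual_point hf x)

theorem toDual_injOn : Set.InjOn toDual {f : X → ℝ | IsBddLip f} := fun f hf g hg h =>
  funext fun x => by rw [← toDual_point hf, h, toDual_point hg]

theorem toDual_apply_point (φ : evalSpan X →L[ℝ] ℝ) : toDual (fun x => φ (point x)) = φ :=
  toDual_eq fun _ => rfl

variable (X) in
/-- The closed span of the evaluations is a separable predual of `Lip_b(X)`. -/
def predualWitness [TopologicalSpace.SeparableSpace X] : PredualWitness X where
  V := evalSpan X
  normedV := inferInstance
  normedSpaceV := inferInstance
  separableV := separableSpace_evalSpan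
  completeV := inferInstance
  T := toDual
  map_add' := fun _ _ => toDual_add
  map_smul' := fun c _ => toDual_smul c
  norm_eq := fun _ => norm_toDual
  surj := fun φ => ⟨_, isBddLip_apply_point φ, toDual_apply_point φ⟩
  inj := fun _ _ hf hg => toDual_injOn hf hg

end LipPredual

/-- For every separable metric space `X`, the Banach space `Lip_b(X)`
is a dual Banach space with separable pre-dual. -/
theorem lipb_is_dual_of_separable_predual
    (X : Type) [MetricSpace X] [TopologicalSpace.SeparableSpace X] :
    Nonempty (PredualWitness X) := by
  exact ⟨LipPredual.predualWitness X⟩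
end
end

section
/- (Uncrossing of Lipschitz graphs.) Let N ∈ ℕ and let g_1, …, g_N : ℝ → ℝ be 1-Lipschitz functions. Then there exist 1-Lipschitz functions f_1, …, f_N : ℝ → ℝ such that f_{j-1}(t) ≤ f_j(t) for all t ∈ ℝ and all 1 < j ≤ N, and the unions of graphs agree: ⋃_{j=1}^N {(t, g_j(t)) : t ∈ ℝ} = ⋃_{j=1}^N {(t, f_j(t)) : t ∈ ℝ}. Moreover, if each g_j is piecewise linear then each f_j can be chosen piecewise linear. -/
open scoped NNReal

/-- A function `g : ℝ → ℝ` is piecewise linear: there is a finite set `s` of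
breakpoints such that `g` is affine on every connected set avoiding `s`. -/
def PiecewiseLinear (g : ℝ → ℝ) : Prop :=
  ∃ s : Finset ℝ, ∀ I : Set ℝ, IsConnected I → (∀ x ∈ s, x ∉ I) →
    ∃ a b : ℝ, ∀ x ∈ I, g x = a * x + b

theorem PiecewiseLinear.sub {g h : ℝ → ℝ} (hg : PiecewiseLinear g) (hh : PiecewiseLinear h) :
    PiecewiseLinear (fun x => g x - h x) := by
  classical
  obtain ⟨s, hs⟩ := hg
  obtain ⟨t, ht⟩ := hh
  refine ⟨s ∪ t, fun I hI hd => ?_⟩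
  obtain ⟨a, b, hab⟩ := hs I hI fun x hx => hd x (Finset.mem_union_left _ hx)
  obtain ⟨c, d, hcd⟩ := ht I hI fun x hx => hd x (Finset.mem_union_right _ hx)
  refine ⟨a - c, b - d, fun x hx => ?_⟩
  simp only [hab x hx, hcd x hx]
  ring

/-- Away from finitely many points, a piecewise linear function does not change sign. -/
theorem PiecewiseLinear.exists_finset_nonpos_imp_nonpos {h : ℝ → ℝ} (hh : PiecewiseLinear h) :
    ∃ z : Finset ℝ, ∀ I : Set ℝ, IsConnected I → (∀ x ∈ z, x ∉ I) →
      ∀ x ∈ I, ∀ y ∈ I, h x ≤ 0 → h y ≤ 0 := by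
  classical
  obtain ⟨s, hs⟩ := hh
  let C : Finset ℝ → Set ℝ := fun u => {x | x ∉ s ∧ {p ∈ s | p < x} = u}
  have hC : ∀ u, ∃ a b : ℝ, ∀ x ∈ C u, h x = a * x + b := by
    intro u
    rcases (C u).eq_empty_or_nonempty with he | hne
    · exact ⟨0, 0, by simp [he]⟩
    · refine hs _ ⟨hne, Set.OrdConnected.isPreconnected ⟨?_⟩⟩ fun x hx hxC => hxC.1 hx
      rintro x ⟨hxs, hx⟩ y ⟨hys, hy⟩ w ⟨hxw, hwy⟩
      have key : ∀ p ∈ s, (p < x ↔ p < y) := fun p hp => by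
        have := Finset.ext_iff.1 (hx.trans hy.symm) p
        simpa [hp] using this
      refine ⟨fun hw => ?_, ?_⟩
      · have hwx : x < w := lt_of_le_of_ne hxw fun e => hxs (e ▸ hw)
        have hwy' : w < y := lt_of_le_of_ne hwy fun e => hys (e ▸ hw)
        exact absurd ((key w hw).2 hwy') hwx.not_gt
      · rw [← hx]
        refine Finset.filter_congr fun p hp => ⟨fun hpw => ?_, fun hpx => hpx.trans_le hxw⟩
        exact (key p hp).2 (hpw.trans_le hwy)
  choose a b hab using hC
  refine ⟨s ∪ s.powerset.image fun u => -b u / a u, fun I hI hd x hx y hy hle => ?_⟩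
  have hds : ∀ p ∈ s, p ∉ I := fun p hp => hd p (Finset.mem_union_left _ hp)
  have hoc : I.OrdConnected := hI.isPreconnected.ordConnected
  set u : Finset ℝ := {p ∈ s | p < x} with hu
  have hIu : ∀ w ∈ I, w ∈ C u := by
    intro w hw
    refine ⟨fun hws => hds w hws hw, Finset.filter_congr fun p hp => ⟨fun hpw => ?_, fun hpx => ?_⟩⟩
    · by_contra! hxp
      exact hds p hp (hoc.out hx hw ⟨hxp, hpw.le⟩)
    · by_contra! hwp
      exact hds p hp (hoc.out hw hx ⟨hwp, hpx.le⟩)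
  have hz : -b u / a u ∉ I := hd _ <| Finset.mem_union_right _ <|
    Finset.mem_image_of_mem _ (Finset.mem_powerset.2 (Finset.filter_subset _ _))
  rw [hab u x (hIu x hx)] at hle
  rw [hab u y (hIu y hy)]
  by_contra! hlt
  apply hz
  rcases lt_trichotomy (a u) 0 with ha | ha | ha
  · refine hoc.out hy hx ⟨?_, ?_⟩
    · rw [le_div_iff_of_neg ha]; linarith
    · rw [div_le_iff_of_neg ha]; linarith
  · rw [ha] at hle hlt
    linarith
  · refine hoc.out hx hy ⟨?_, ?_⟩
    · rw [le_div_iff₀ ha]; linarith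
    · rw [div_le_iff₀ ha]; linarith

/-- Two permutations of `Fin N`: some index lies among the first `j + 1` values of one
and among the last `N - j` values of the other. -/
theorem Equiv.Perm.exists_le_le_apply_eq {N : ℕ} (σ τ : Equiv.Perm (Fin N)) (j : Fin N) :
    ∃ a b : Fin N, a ≤ j ∧ j ≤ b ∧ σ a = τ b := by
  by_contra! hne
  have hd : _root_.Disjoint ((Finset.Iic j).map σ.toEmbedding) ((Finset.Ici j).map τ.toEmbedding) := by
    rw [Finset.disjoint_left]
    intro i hi hi'
    simp only [Finset.mem_map, Finset.mem_Iic, Finset.mem_Ici] at hi hi'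
    obtain ⟨a, ha, rfl⟩ := hi
    obtain ⟨b, hb, hba⟩ := hi'
    exact hne a b ha hb hba.symm
  have hcard := Finset.card_le_univ (Finset.disjUnion _ _ hd)
  simp only [Finset.card_disjUnion, Finset.card_map, Fin.card_Iic, Fin.card_Ici,
    Fintype.card_fin] at hcard
  omega

/-- The order statistics of a finite tuple are monotone and 1-Lipschitz in the sup distance. -/
theorem Tuple.sort_apply_le_add {N : ℕ} {v w : Fin N → ℝ} {r : ℝ} (h : ∀ i, v i ≤ w i + r)
    (j : Fin N) : v (Tuple.sort v j) ≤ w (Tuple.sort w j) + r := by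
  obtain ⟨a, b, ha, hb, hab⟩ := (Tuple.sort w).exists_le_le_apply_eq (Tuple.sort v) j
  have h₁ : v (Tuple.sort v j) ≤ v (Tuple.sort v b) := Tuple.monotone_sort v hb
  have h₂ : w (Tuple.sort w a) ≤ w (Tuple.sort w j) := Tuple.monotone_sort w ha
  have h₃ := h (Tuple.sort v b)
  rw [← hab] at h₁ h₃
  linarith

theorem PiecewiseLinear.sort {N : ℕ} {g : Fin N → ℝ → ℝ} (hg : ∀ j, PiecewiseLinear (g j))
    (j : Fin N) : PiecewiseLinear (fun t => g (Tuple.sort (fun i => g i t) j) t) := by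
  classical
  choose z hz using fun p : Fin N × Fin N =>
    ((hg p.1).sub (hg p.2)).exists_finset_nonpos_imp_nonpos
  choose s hs using hg
  refine ⟨Finset.univ.biUnion s ∪ Finset.univ.biUnion z, fun I hI hd => ?_⟩
  obtain ⟨t₀, ht₀⟩ := hI.nonempty
  set σ := Tuple.sort fun i => g i t₀ with hσ
  obtain ⟨a, b, hab⟩ := hs (σ j) I hI fun x hx => hd x <|
    Finset.mem_union_left _ (Finset.mem_biUnion.2 ⟨_, Finset.mem_univ _, hx⟩)
  refine ⟨a, b, fun t ht => ?_⟩
  have hmono : Monotone ((fun i => g i t) ∘ σ) := by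
    intro k l hkl
    have h₀ : g (σ k) t₀ ≤ g (σ l) t₀ := Tuple.monotone_sort (fun i => g i t₀) hkl
    have h₁ := hz (σ k, σ l) I hI (fun x hx => hd x <|
      Finset.mem_union_right _ (Finset.mem_biUnion.2 ⟨_, Finset.mem_univ _, hx⟩))
      t₀ ht₀ t ht (sub_nonpos.2 h₀)
    exact sub_nonpos.1 h₁
  have heq := congrFun (Tuple.comp_sort_eq_comp_iff_monotone.2 hmono) j
  exact heq.symm.trans (hab t ht)

/-- **Uncrossing of Lipschitz graphs.** Given 1-Lipschitz functions
`g₁,…,g_N : ℝ → ℝ`, there are 1-Lipschitz functions `f₁ ≤ f₂ ≤ … ≤ f_N` whose graphs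
have the same union as the graphs of the `g_j`; if the `g_j` are piecewise linear, the
`f_j` can be chosen piecewise linear. -/
theorem uncrossing_lipschitz_graphs
    (N : ℕ) (g : Fin N → ℝ → ℝ) (hg : ∀ j, LipschitzWith 1 (g j)) :
    ∃ f : Fin N → ℝ → ℝ,
      (∀ j, LipschitzWith 1 (f j)) ∧
      (∀ j k : Fin N, j ≤ k → ∀ t : ℝ, f j t ≤ f k t) ∧
      ((⋃ j, {p : ℝ × ℝ | p.2 = g j p.1}) = ⋃ j, {p : ℝ × ℝ | p.2 = f j p.1}) ∧
      ((∀ j, PiecewiseLinear (g j)) → ∀ j, PiecewiseLinear (f j)) := by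
  refine ⟨fun j t => g (Tuple.sort (fun i => g i t) j) t, fun j => ?_, fun j k hjk t => ?_, ?_,
    PiecewiseLinear.sort⟩
  · refine LipschitzWith.of_le_add fun x y => ?_
    refine Tuple.sort_apply_le_add (v := fun i => g i x) (w := fun i => g i y) (fun i => ?_) j
    simpa using (hg i).le_add_mul x y
  · exact Tuple.monotone_sort (fun i => g i t) hjk
  · ext ⟨t, y⟩
    simp only [Set.mem_iUnion, Set.mem_ofPred_eq]
    exact (Tuple.sort fun i => g i t).surjective.exists
end

section
/- (Disjointification of stripes.) Let N ∈ ℕ, δ > 0, and let g_1, …, g_N : ℝ → ℝ be 1-Lipschitz functions. Then there exist 1-Lipschitz functions h_1, …, h_N : ℝ → ℝ such that ⋃_{l=1}^N N¹(g_l;δ) ⊆ ⋃_{l=1}^N N¹(h_l;δ) and the stripes N¹(h_1;δ), …, N¹(h_N;δ) have pairwise disjoint interiors. -/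
open scoped NNReal

/-- The `x₁`-stripe of thickness `δ` around the graph of `g : ℝ → ℝ`:
`N¹(g;δ) = {(t,y) : |y − g(t)| ≤ δ/2}`. -/
def Stripe (g : ℝ → ℝ) (δ : ℝ) : Set (ℝ × ℝ) :=
  {p : ℝ × ℝ | |p.2 - g p.1| ≤ δ / 2}

/-- Sorting is monotone, up to an additive constant. -/
theorem sorted_le_sorted_add {n : ℕ} {u v : Fin n → ℝ} {c : ℝ} (huv : ∀ i, u i ≤ v i + c)
    {σ τ : Equiv.Perm (Fin n)} (hσ : Monotone (u ∘ σ)) (hτ : Monotone (v ∘ τ)) (k : Fin n) :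
    u (σ k) ≤ v (τ k) + c := by
  obtain ⟨j, hjk, hkj⟩ : ∃ j ≤ k, k ≤ σ.symm (τ j) := by
    by_contra! H
    have hcard := Finset.card_le_card_of_injOn (s := Finset.Iic k) (t := Finset.Iio k)
      (fun j => σ.symm (τ j)) (fun j hj => by simpa using H j (by simpa using hj))
      (σ.symm.injective.comp τ.injective).injOn
    simp at hcard
  have h₁ : u (σ k) ≤ u (τ j) := by simpa using hσ hkj
  have h₂ : v (τ j) ≤ v (τ k) := hτ hjk
  linarith [huv (τ j)]

/-- The least sequence above `a` whose consecutive gaps are at least `δ`. -/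
noncomputable def spread (δ : ℝ) (a : ℕ → ℝ) : ℕ → ℝ
  | 0 => a 0
  | k + 1 => max (a (k + 1)) (spread δ a k + δ)

theorem spread_le_spread_add {δ c : ℝ} {a b : ℕ → ℝ} (hab : ∀ k, a k ≤ b k + c) (k : ℕ) :
    spread δ a k ≤ spread δ b k + c := by
  induction k with
  | zero => exact hab 0
  | succ k ih =>
    have h₁ := le_max_left (b (k + 1)) (spread δ b k + δ)
    have h₂ := le_max_right (b (k + 1)) (spread δ b k + δ)
    exact max_le (by linarith [hab (k + 1), spread.eq_2 δ b k])
      (by linarith [spread.eq_2 δ b k])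

theorem le_spread (δ : ℝ) (a : ℕ → ℝ) (k : ℕ) : a k ≤ spread δ a k := by
  cases k with
  | zero => exact le_rfl
  | succ k => exact le_max_left _ _

theorem spread_add_le_spread {δ : ℝ} (hδ : 0 ≤ δ) (a : ℕ → ℝ) {i j : ℕ} (hij : i < j) :
    spread δ a i + δ ≤ spread δ a j := by
  induction j, hij using Nat.le_induction with
  | base => exact le_max_right _ _
  | succ j _ ih =>
    have : spread δ a j + δ ≤ spread δ a (j + 1) := le_max_right _ _
    linarith

theorem exists_abs_sub_spread_le {δ : ℝ} {a : ℕ → ℝ} {y : ℝ} (k : ℕ)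
    (ha : ∀ i < k, a i ≤ a (i + 1)) (hy : a k - δ / 2 ≤ y) (hy' : y ≤ spread δ a k + δ / 2) :
    ∃ j ≤ k, |y - spread δ a j| ≤ δ / 2 := by
  induction k with
  | zero =>
    refine ⟨0, le_rfl, abs_le.2 ⟨?_, by linarith⟩⟩
    have : spread δ a 0 = a 0 := rfl
    linarith
  | succ k ih =>
    by_cases h : spread δ a (k + 1) - δ / 2 ≤ y
    · exact ⟨k + 1, le_rfl, abs_le.2 ⟨by linarith, by linarith⟩⟩
    · have hs : spread δ a (k + 1) = max (a (k + 1)) (spread δ a k + δ) := rfl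
      obtain ⟨j, hj, hjy⟩ := ih (fun i hi => ha i (by omega))
        (by linarith [ha k (by omega)])
        (by rcases max_choice (a (k + 1)) (spread δ a k + δ) with h' | h' <;> linarith)
      exact ⟨j, by omega, hjy⟩

theorem abs_sub_lt_of_mem_interior_stripe {g : ℝ → ℝ} {δ : ℝ} (hδ : 0 < δ) {p : ℝ × ℝ}
    (hp : p ∈ interior (Stripe g δ)) : |p.2 - g p.1| < δ / 2 := by
  have hc : Continuous fun y : ℝ => (p.1, y) := by fun_prop
  have h : p.2 ∈ interior (Metric.closedBall (g p.1) (δ / 2)) :=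
    preimage_interior_subset_interior_preimage hc (show p.2 ∈ _ from hp)
  rwa [interior_closedBall _ (by positivity), Metric.mem_ball, Real.dist_eq] at h

theorem disjoint_interior_stripe {g h : ℝ → ℝ} {δ : ℝ} (hδ : 0 < δ)
    (hgh : ∀ t, g t + δ ≤ h t) :
    interior (Stripe g δ) ∩ interior (Stripe h δ) = ∅ := by
  refine Set.eq_empty_of_forall_notMem fun p ⟨hp, hp'⟩ => ?_
  have h₁ := abs_lt.1 (abs_sub_lt_of_mem_interior_stripe hδ hp)
  have h₂ := abs_lt.1 (abs_sub_lt_of_mem_interior_stripe hδ hp')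
  linarith [hgh p.1]

/-- **Disjointification of stripes.** Given finitely many `x₁`-stripes
of thickness `δ` with 1-Lipschitz cores `g₁,…,g_N`, there are 1-Lipschitz functions
`h₁,…,h_N` whose stripes of thickness `δ` cover the original stripes and have pairwise
disjoint interiors. -/
theorem disjointification_of_stripes
    (N : ℕ) (δ : ℝ) (hδ : 0 < δ) (g : Fin N → ℝ → ℝ)
    (hg : ∀ l, LipschitzWith 1 (g l)) :
    ∃ h : Fin N → ℝ → ℝ,
      (∀ l, LipschitzWith 1 (h l)) ∧
      (⋃ l, Stripe (g l) δ) ⊆ (⋃ l, Stripe (h l) δ) ∧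
      (∀ l l' : Fin N, l ≠ l' →
        interior (Stripe (h l) δ) ∩ interior (Stripe (h l') δ) = ∅) := by
  let a : ℝ → ℕ → ℝ := fun t k =>
    if hk : k < N then g (Tuple.sort (fun l => g l t) ⟨k, hk⟩) t else 0
  have a_of_lt (t : ℝ) (k : Fin N) : a t k = g (Tuple.sort (fun l => g l t) k) t := by
    simp [a]
  have a_mono (t : ℝ) {i j : Fin N} (hij : i ≤ j) : a t i ≤ a t j := by
    rw [a_of_lt, a_of_lt]
    exact Tuple.monotone_sort (fun l => g l t) hij
  have a_le (s t : ℝ) (k : ℕ) : a s k ≤ a t k + dist s t := by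
    by_cases hk : k < N
    · simp only [a, hk, dif_pos]
      refine sorted_le_sorted_add (u := fun l => g l s) (v := fun l => g l t) (fun l => ?_)
        (Tuple.monotone_sort _) (Tuple.monotone_sort _) _
      simpa using (hg l).le_add_mul s t
    · simp [a, hk]
  refine ⟨fun l t => spread δ (a t) l, fun l => ?_, ?_, fun l l' hl => ?_⟩
  · exact LipschitzWith.of_le_add fun s t => spread_le_spread_add (a_le s t) l
  · refine Set.iUnion_subset fun l p hp => ?_
    let k := (Tuple.sort fun l => g l p.1).symm l
    have hk : a p.1 k = g l p.1 := by simp [a_of_lt, k]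
    have hp' := abs_le.1 (show |p.2 - g l p.1| ≤ δ / 2 from hp)
    obtain ⟨j, hj, hjp⟩ := exists_abs_sub_spread_le (δ := δ) (a := a p.1) (y := p.2) k
      (fun i hi => a_mono p.1 (i := ⟨i, by omega⟩) (j := ⟨i + 1, by omega⟩) (by simp))
      (by linarith) (by linarith [le_spread δ (a p.1) k])
    exact Set.mem_iUnion.2 ⟨⟨j, by omega⟩, hjp⟩
  · rcases lt_or_gt_of_ne hl with h | h
    · exact disjoint_interior_stripe hδ fun t => spread_add_le_spread hδ.le _ h
    · rw [Set.inter_comm]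
      exact disjoint_interior_stripe hδ fun t => spread_add_le_spread hδ.le _ h
end

section
/- Let 0 < L < 1 and let E ⊆ ℝ² be a set with the property that for every ε > 0 there exist countably many x₁-stripes N¹(f_j;δ_j) (j ∈ ℕ, each f_j : ℝ → ℝ 1-Lipschitz, δ_j > 0) with E ⊆ ⋃_j N¹(f_j;δ_j) and Σ_j δ_j < ε. Then for every L-Lipschitz function g : ℝ → ℝ, the intersection of E with the x₂-curve γ²(g) = {(g(t), t) : t ∈ ℝ} has 1-dimensional Hausdorff measure zero: H¹(E ∩ γ²(g)) = 0. -/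
open MeasureTheory
open scoped ENNReal NNReal

/-- If `f` is `1`-Lipschitz and `g` is `L`-Lipschitz with `L < 1`, then the set of parameters `t`
at which the curve `(g t, t)` meets the stripe of thickness `δ` around `f` has measure at most
`δ / (1 - L)`. -/
theorem volume_setOf_abs_sub_comp_le {L : ℝ≥0} (hL : (L : ℝ) < 1) {f g : ℝ → ℝ}
    (hf : LipschitzWith 1 f) (hg : LipschitzWith L g) (δ : ℝ) :
    volume {t : ℝ | |t - f (g t)| ≤ δ / 2} ≤ ENNReal.ofReal (δ / (1 - L)) := by
  refine (Real.volume_le_diam _).trans (Metric.ediam_le fun s hs t ht => ?_)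
  rw [edist_dist]
  refine ENNReal.ofReal_le_ofReal ?_
  rw [le_div_iff₀ (sub_pos.2 hL)]
  have h : |f (g s) - f (g t)| ≤ L * |s - t| := by
    simpa [Real.dist_eq] using (hf.comp hg).dist_le_mul s t
  have hst : |s - t| ≤ |s - f (g s)| + |f (g s) - f (g t)| + |t - f (g t)| := by
    rw [abs_sub_comm t]
    exact (abs_sub_le s (f (g t)) t).trans (by gcongr; exact abs_sub_le _ _ _)
  rw [Set.mem_ofPred_eq] at hs ht
  rw [Real.dist_eq]
  linarith

/-- The parametrization `t ↦ (g t, t)` of an `x₂`-curve is Lipschitz. -/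
theorem lipschitzWith_graph_euclidean {L : ℝ≥0} {g : ℝ → ℝ} (hg : LipschitzWith L g) :
    LipschitzWith (L + 1) fun t : ℝ => (!₂[g t, t] : EuclideanSpace ℝ (Fin 2)) := by
  refine LipschitzWith.of_dist_le_mul fun s t => ?_
  have h := hg.dist_le_mul s t
  have h₀ : 0 ≤ dist (g s) (g t) := dist_nonneg
  have h₁ : 0 ≤ dist s t := dist_nonneg
  rw [EuclideanSpace.dist_eq]
  refine Real.sqrt_le_iff.2 ⟨by positivity, ?_⟩
  simp only [Fin.sum_univ_two, Matrix.cons_val_zero, Matrix.cons_val_one, NNReal.coe_add,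
    NNReal.coe_one]
  calc dist (g s) (g t) ^ 2 + dist s t ^ 2 ≤ (dist (g s) (g t) + dist s t) ^ 2 := by
        nlinarith [mul_nonneg h₀ h₁]
    _ ≤ ((L + 1) * dist s t) ^ 2 := by gcongr; linarith

/-- Let `0 < L < 1` and let `E ⊆ ℝ²` be a set that, for every
`ε > 0`, can be covered by countably many `x₁`-stripes
`N¹(f_j; δ_j) = {p : |p 1 − f_j (p 0)| ≤ δ_j/2}` (with each `f_j` 1-Lipschitz) of total
thickness `Σ_j δ_j < ε`.  Then for every `L`-Lipschitz `g : ℝ → ℝ`, the intersection of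
`E` with the `x₂`-curve `γ²(g) = {(g t, t)}` is `H¹`-null. -/
theorem stripes_meet_transverse_curve_null
    (L : ℝ≥0) (hL0 : 0 < L) (hL1 : (L : ℝ) < 1)
    (E : Set (EuclideanSpace ℝ (Fin 2)))
    (hE : ∀ ε : ℝ, 0 < ε → ∃ (f : ℕ → ℝ → ℝ) (δ : ℕ → ℝ),
      (∀ j, LipschitzWith 1 (f j)) ∧ (∀ j, 0 < δ j) ∧
      (E ⊆ ⋃ j, {p : EuclideanSpace ℝ (Fin 2) | |p 1 - f j (p 0)| ≤ δ j / 2}) ∧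
      (∑' j, ENNReal.ofReal (δ j)) < ENNReal.ofReal ε)
    (g : ℝ → ℝ) (hg : LipschitzWith L g) :
    (μH[1] : Measure (EuclideanSpace ℝ (Fin 2)))
      (E ∩ {p : EuclideanSpace ℝ (Fin 2) | p 0 = g (p 1)}) = 0 := by
  have hL : 0 < 1 - (L : ℝ) := sub_pos.2 hL1
  set γ : ℝ → EuclideanSpace ℝ (Fin 2) := fun t => !₂[g t, t] with hγ
  have hsub : E ∩ {p : EuclideanSpace ℝ (Fin 2) | p 0 = g (p 1)} ⊆ γ '' (γ ⁻¹' E) := by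
    rintro p ⟨hpE, hp⟩
    have hp' : γ (p 1) = p := by
      ext i
      fin_cases i
      · exact hp.symm
      · rfl
    exact ⟨p 1, by rwa [Set.mem_preimage, hp'], hp'⟩
  have hnull : volume (γ ⁻¹' E) = 0 := by
    refine le_antisymm (ENNReal.le_of_forall_pos_le_add fun ε hε _ => ?_) zero_le
    obtain ⟨f, δ, hf, -, hcover, hsum⟩ := hE (ε * (1 - L)) (by positivity)
    have hcover' : γ ⁻¹' E ⊆ ⋃ j, {t : ℝ | |t - f j (g t)| ≤ δ j / 2} := fun t ht => by
      simpa [hγ] using hcover ht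
    calc volume (γ ⁻¹' E) ≤ ∑' j, volume {t : ℝ | |t - f j (g t)| ≤ δ j / 2} :=
          (measure_mono hcover').trans (measure_iUnion_le _)
      _ ≤ ∑' j, ENNReal.ofReal (δ j / (1 - L)) :=
          ENNReal.tsum_le_tsum fun j => volume_setOf_abs_sub_comp_le hL1 (hf j) hg (δ j)
      _ = (∑' j, ENNReal.ofReal (δ j)) / ENNReal.ofReal (1 - L) := by
          simp_rw [ENNReal.ofReal_div_of_pos hL, div_eq_mul_inv, ENNReal.tsum_mul_right]
      _ ≤ ENNReal.ofReal (ε * (1 - L)) / ENNReal.ofReal (1 - L) := by gcongr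
      _ = 0 + ε := by
          rw [← ENNReal.ofReal_div_of_pos hL, mul_div_cancel_right₀ _ hL.ne',
            ENNReal.ofReal_coe_nnreal, zero_add]
  refine measure_mono_null hsub (le_antisymm ?_ zero_le)
  have h := (lipschitzWith_graph_euclidean hg).hausdorffMeasure_image_le zero_le_one (γ ⁻¹' E)
  rwa [hausdorffMeasure_real, hnull, mul_zero] at h
end

section
/- Let N ∈ ℕ, δ > 0, and let f_1, …, f_N : ℝ → ℝ be 1-Lipschitz functions satisfying f_{l+1}(t) ≥ f_l(t) + δ for all t ∈ ℝ and 1 ≤ l < N (so the x₁-stripes N¹(f_l;δ) have pairwise disjoint interiors). Let M = ℝ² ∖ ⋃_{l=1}^N N¹(f_l;δ) and define φ : ℝ × [0,∞) → ℝ by φ(p_1,p_2) = ∫_0^{p_2} χ_M(p_1,t) dt. Then φ is 3-Lipschitz, and 0 ≤ p_2 − φ(p_1,p_2) ≤ N·δ for all (p_1,p_2) with p_2 ≥ 0. -/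
open MeasureTheory
open scoped NNReal

/-- The part of the stripes lying above the abscissa `s`, as a set of ordinates. -/
def stripeSlice {N : ℕ} (f : Fin N → ℝ → ℝ) (δ s : ℝ) : Set ℝ :=
  ⋃ l, Set.Icc (f l s - δ / 2) (f l s + δ / 2)

theorem measurableSet_stripeSlice {N : ℕ} (f : Fin N → ℝ → ℝ) (δ s : ℝ) :
    MeasurableSet (stripeSlice f δ s) :=
  MeasurableSet.iUnion fun _ => measurableSet_Icc

theorem add_le_of_lt_of_consecutive {N : ℕ} {δ : ℝ} (hδ : 0 ≤ δ) {a : Fin N → ℝ}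
    (hsep : ∀ (l : Fin N) (h : (l : ℕ) + 1 < N), a l + δ ≤ a ⟨(l : ℕ) + 1, h⟩)
    {l m : Fin N} (hlm : l < m) : a l + δ ≤ a m := by
  obtain ⟨m, hm⟩ := m
  induction m with
  | zero => exact absurd hlm (by simp [Fin.lt_def])
  | succ k ih =>
    have hk : k < N := by omega
    have hstep := hsep ⟨k, hk⟩ hm
    rcases Nat.lt_succ_iff_lt_or_eq.mp (Fin.lt_def.mp hlm) with h | h
    · have := ih hk (Fin.lt_def.mpr h)
      linarith
    · have hl : l = ⟨k, hk⟩ := Fin.ext h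
      rw [hl]
      exact hstep

theorem aedisjoint_Icc_of_add_le {δ a b : ℝ} (h : a + δ ≤ b) :
    AEDisjoint volume (Set.Icc (a - δ / 2) (a + δ / 2)) (Set.Icc (b - δ / 2) (b + δ / 2)) := by
  refine measure_mono_null (t := {a + δ / 2}) ?_ (by simp)
  rintro x ⟨⟨_, h2⟩, ⟨h3, _⟩⟩
  rw [Set.mem_singleton_iff]
  linarith

theorem measureReal_stripeSlice_inter {N : ℕ} {f : Fin N → ℝ → ℝ} {δ s : ℝ} (hδ : 0 ≤ δ)
    (hsep : ∀ (l : Fin N) (h : (l : ℕ) + 1 < N), f l s + δ ≤ f ⟨(l : ℕ) + 1, h⟩ s)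
    {J : Set ℝ} (hJ : MeasurableSet J) :
    volume.real (stripeSlice f δ s ∩ J) =
      ∑ l, volume.real (Set.Icc (f l s - δ / 2) (f l s + δ / 2) ∩ J) := by
  have hdisj : Pairwise (Function.onFun (AEDisjoint volume)
      fun l => Set.Icc (f l s - δ / 2) (f l s + δ / 2) ∩ J) := by
    intro l m hlm
    refine AEDisjoint.mono ?_ Set.inter_subset_left Set.inter_subset_left
    rcases lt_or_gt_of_ne hlm with h | h
    · exact aedisjoint_Icc_of_add_le
        (add_le_of_lt_of_consecutive (a := fun l => f l s) hδ hsep h)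
    · exact (aedisjoint_Icc_of_add_le
        (add_le_of_lt_of_consecutive (a := fun l => f l s) hδ hsep h)).symm
  rw [stripeSlice, Set.iUnion_inter, measureReal_def, measure_iUnion₀ hdisj
    fun l => (measurableSet_Icc.inter hJ).nullMeasurableSet, tsum_fintype,
    ENNReal.toReal_sum fun l _ => measure_ne_top_of_subset Set.inter_subset_left (by simp)]
  rfl

theorem measureReal_stripeSlice_inter_le {N : ℕ} {f : Fin N → ℝ → ℝ} {δ : ℝ} (hδ : 0 ≤ δ)
    (s : ℝ) (J : Set ℝ) :
    volume.real (stripeSlice f δ s ∩ J) ≤ N * δ := by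
  calc volume.real (stripeSlice f δ s ∩ J) ≤ volume.real (stripeSlice f δ s) :=
        measureReal_mono Set.inter_subset_left
          ((measure_iUnion_le _).trans_lt
            (by simp [tsum_fintype, ENNReal.mul_lt_top])).ne
    _ ≤ ∑ l, volume.real (Set.Icc (f l s - δ / 2) (f l s + δ / 2)) :=
        measureReal_iUnion_fintype_le _
    _ = N * δ := by
        simp [Real.volume_real_Icc, hδ]

theorem measureReal_stripeSlice_inter_Ioc_le_add {N : ℕ} {f : Fin N → ℝ → ℝ} {δ : ℝ}
    (hδ : 0 ≤ δ) (hlip : ∀ l, LipschitzWith 1 (f l))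
    (hsep : ∀ (l : Fin N) (h : (l : ℕ) + 1 < N) (t : ℝ),
      f l t + δ ≤ f ⟨(l : ℕ) + 1, h⟩ t) (s s' y : ℝ) :
    volume.real (stripeSlice f δ s' ∩ Set.Ioc 0 y) ≤
      volume.real (stripeSlice f δ s ∩ Set.Ioc 0 y) + 2 * |s - s'| := by
  set d := |s - s'| with hd
  have hd0 : 0 ≤ d := abs_nonneg _
  have hcover : stripeSlice f δ s' ∩ Set.Ioc 0 y ⊆
      (stripeSlice f δ s' ∩ Set.Ioc d (y - d)) ∪ (Set.Ioc 0 d ∪ Set.Ioc (y - d) y) := by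
    rintro x ⟨hx, h1, h2⟩
    by_cases h3 : x ≤ d
    · exact Or.inr (Or.inl ⟨h1, h3⟩)
    by_cases h4 : x ≤ y - d
    · exact Or.inl ⟨hx, not_le.mp h3, h4⟩
    · exact Or.inr (Or.inr ⟨not_le.mp h4, h2⟩)
  have htranslate : volume.real (stripeSlice f δ s' ∩ Set.Ioc d (y - d)) ≤
      volume.real (stripeSlice f δ s ∩ Set.Ioc 0 y) := by
    rw [measureReal_stripeSlice_inter hδ (fun l h => hsep l h s') measurableSet_Ioc,
      measureReal_stripeSlice_inter hδ (fun l h => hsep l h s) measurableSet_Ioc]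
    refine Finset.sum_le_sum fun l _ => ?_
    have hmove : |f l s - f l s'| ≤ d := by
      simpa [Real.dist_eq] using (hlip l).dist_le_mul s s'
    obtain ⟨hm1, hm2⟩ := abs_le.mp hmove
    rw [measureReal_def, ← measure_preimage_add_right volume (f l s' - f l s),
      ← measureReal_def]
    refine measureReal_mono ?_ (measure_ne_top_of_subset Set.inter_subset_left (by simp))
    rintro x ⟨⟨h1, h2⟩, h3, h4⟩
    refine ⟨⟨?_, ?_⟩, ?_, ?_⟩ <;> linarith
  have hfin : volume ((stripeSlice f δ s' ∩ Set.Ioc d (y - d)) ∪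
      (Set.Ioc 0 d ∪ Set.Ioc (y - d) y)) ≠ ⊤ := by
    refine measure_union_ne_top (measure_ne_top_of_subset Set.inter_subset_right (by simp))
      (measure_union_ne_top (by simp) (by simp))
  calc volume.real (stripeSlice f δ s' ∩ Set.Ioc 0 y)
      ≤ _ := measureReal_mono hcover hfin
    _ ≤ volume.real (stripeSlice f δ s' ∩ Set.Ioc d (y - d)) +
        (volume.real (Set.Ioc 0 d) + volume.real (Set.Ioc (y - d) y)) :=
        (measureReal_union_le _ _).trans (by gcongr; exact measureReal_union_le _ _)
    _ ≤ _ := by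
        rw [Real.volume_real_Ioc_of_le hd0, Real.volume_real_Ioc_of_le (by linarith)]
        linarith

/-- Let `f₁,…,f_N : ℝ → ℝ` be 1-Lipschitz with
`f_{l+1} ≥ f_l + δ` (so the stripes `N¹(f_l;δ)` have pairwise disjoint interiors), let
`M = ℝ² ∖ ⋃_l N¹(f_l;δ)` and `φ(p₁,p₂) = ∫_0^{p₂} χ_M(p₁,t) dt`.  Then `φ` is
3-Lipschitz on `ℝ × [0,∞)` (w.r.t. the Euclidean distance) and
`0 ≤ p₂ − φ(p₁,p₂) ≤ N·δ` for `p₂ ≥ 0`. -/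
theorem stripe_projection_function_lipschitz
    (N : ℕ) (δ : ℝ) (hδ : 0 < δ) (f : Fin N → ℝ → ℝ)
    (hlip : ∀ l, LipschitzWith 1 (f l))
    (hsep : ∀ (l : Fin N) (h : (l : ℕ) + 1 < N) (t : ℝ),
      f l t + δ ≤ f ⟨(l : ℕ) + 1, h⟩ t)
    (M : Set (ℝ × ℝ)) (hM : M = (Set.univ : Set (ℝ × ℝ)) \ ⋃ l, Stripe (f l) δ)
    (φ : ℝ × ℝ → ℝ)
    (hφ : ∀ p : ℝ × ℝ, φ p = ∫ t in (0 : ℝ)..p.2,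
      Set.indicator M (fun _ => (1 : ℝ)) (p.1, t)) :
    (∀ p q : ℝ × ℝ, 0 ≤ p.2 → 0 ≤ q.2 →
      |φ p - φ q| ≤ 3 * Real.sqrt ((p.1 - q.1) ^ 2 + (p.2 - q.2) ^ 2)) ∧
    (∀ p : ℝ × ℝ, 0 ≤ p.2 → 0 ≤ p.2 - φ p ∧ p.2 - φ p ≤ (N : ℝ) * δ) := by
  have hslice : ∀ s t : ℝ, (s, t) ∈ M ↔ t ∉ stripeSlice f δ s := by
    intro s t
    simp only [hM, stripeSlice, Stripe, Set.mem_sdiff, Set.mem_univ, true_and, Set.mem_iUnion,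
      Set.mem_ofPred_eq, Set.mem_Icc, abs_le]
    refine not_congr (exists_congr fun l => ?_)
    constructor <;> rintro ⟨h1, h2⟩ <;> constructor <;> linarith
  have hφ_measure : ∀ p : ℝ × ℝ, 0 ≤ p.2 →
      φ p = volume.real (Set.Ioc 0 p.2 \ stripeSlice f δ p.1) := by
    rintro ⟨s, y⟩ hy
    have hind : (fun t => Set.indicator M (fun _ => (1 : ℝ)) (s, t)) =
        Set.indicator (stripeSlice f δ s)ᶜ 1 := by
      funext t
      by_cases ht : t ∈ stripeSlice f δ s <;> simp [hslice, ht]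
    rw [hφ, intervalIntegral.integral_of_le hy, hind,
      integral_indicator_one (measurableSet_stripeSlice f δ s).compl,
      measureReal_restrict_apply (measurableSet_stripeSlice f δ s).compl, Set.inter_comm,
      Set.sdiff_eq]
  have hcompl : ∀ p : ℝ × ℝ, 0 ≤ p.2 →
      p.2 - φ p = volume.real (stripeSlice f δ p.1 ∩ Set.Ioc 0 p.2) := by
    intro p hp
    have h := measureReal_inter_add_sdiff (μ := volume) (s := Set.Ioc 0 p.2)
      (measurableSet_stripeSlice f δ p.1) (by simp)
    rw [Real.volume_real_Ioc_of_le hp, sub_zero] at h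
    rw [hφ_measure p hp, Set.inter_comm]
    linarith
  have hvert : ∀ s y y' : ℝ, 0 ≤ y → 0 ≤ y' → φ (s, y) - φ (s, y') ≤ |y - y'| := by
    intro s y y' hy hy'
    rw [hφ_measure (s, y) hy, hφ_measure (s, y') hy', sub_le_iff_le_add']
    have hsub : Set.Ioc 0 y \ stripeSlice f δ s ⊆
        (Set.Ioc 0 y' \ stripeSlice f δ s) ∪ Set.Ioc y' y := by
      rintro x ⟨⟨h1, h2⟩, h3⟩
      by_cases h4 : x ≤ y'
      · exact Or.inl ⟨⟨h1, h4⟩, h3⟩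
      · exact Or.inr ⟨not_le.mp h4, h2⟩
    have hfin : volume ((Set.Ioc 0 y' \ stripeSlice f δ s) ∪ Set.Ioc y' y) ≠ ⊤ :=
      measure_union_ne_top (measure_ne_top_of_subset Set.sdiff_subset (by simp)) (by simp)
    refine (measureReal_mono hsub hfin).trans ((measureReal_union_le _ _).trans ?_)
    gcongr
    rw [Real.volume_real_Ioc]
    exact max_le (le_abs_self _) (abs_nonneg _)
  have hhoriz : ∀ s s' y : ℝ, 0 ≤ y → φ (s, y) - φ (s', y) ≤ 2 * |s - s'| := by
    intro s s' y hy
    have h1 := hcompl (s, y) hy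
    have h2 := hcompl (s', y) hy
    have h3 := measureReal_stripeSlice_inter_Ioc_le_add hδ.le hlip hsep s s' y
    dsimp only at h1 h2
    linarith
  have hone_sided : ∀ p q : ℝ × ℝ, 0 ≤ p.2 → 0 ≤ q.2 →
      φ p - φ q ≤ 3 * Real.sqrt ((p.1 - q.1) ^ 2 + (p.2 - q.2) ^ 2) := by
    rintro ⟨s, y⟩ ⟨s', y'⟩ hy hy'
    have h1 := hvert s y y' hy hy'
    have h2 := hhoriz s s' y' hy'
    have h3 : |s - s'| ≤ Real.sqrt ((s - s') ^ 2 + (y - y') ^ 2) :=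
      Real.abs_le_sqrt (by nlinarith [sq_nonneg (y - y')])
    have h4 : |y - y'| ≤ Real.sqrt ((s - s') ^ 2 + (y - y') ^ 2) :=
      Real.abs_le_sqrt (by nlinarith [sq_nonneg (s - s')])
    dsimp only
    linarith
  refine ⟨fun p q hp hq => abs_sub_le_iff.mpr ⟨hone_sided p q hp hq, ?_⟩, fun p hp => ?_⟩
  · have h := hone_sided q p hq hp
    rwa [← neg_sq (q.1 - p.1), ← neg_sq (q.2 - p.2), neg_sub, neg_sub] at h
  · rw [hcompl p hp]
    exact ⟨measureReal_nonneg, measureReal_stripeSlice_inter_le hδ.le p.1 _⟩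
end
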